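/- For each L > 0 there exist constants c₂, c₃ ≥ 1 such that for all r, t > 0 with r φ(1/t) ≥ L: (1/(c₂ t)) exp(−c₃ t (φ')^{-1}(t/r)) ≤ p̄(r,t) ≤ (c₂/t) exp(−(1/c₃) t (φ')^{-1}(t/r)). -/

import Mathlib

open MeasureTheory Filter Set
open scoped ENNReal Topology

theorem measure_eq_of_mgf_eqOn {μ μ' : Measure ℝ} [IsFiniteMeasure μ] [IsFiniteMeasure μ'] {b : ℝ}
    (hb : 0 < b)
    (hμ : ∀ z < b, Integrable (fun x => Real.exp (z * x)) μ)
    (hμ' : ∀ z < b, Integrable (fun x => Real.exp (z * x)) μ')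
    (h : ∀ z < b, ∫ x, Real.exp (z * x) ∂μ = ∫ x, Real.exp (z * x) ∂μ') : μ = μ' := by
  have hsub : ∀ {m : Measure ℝ}, (∀ z < b, Integrable (fun x => Real.exp (z * x)) m) →
      Iio b ⊆ interior (ProbabilityTheory.integrableExpSet id m) := fun hm =>
    interior_maximal (fun z hz => hm z hz) isOpen_Iio
  let U : Set ℂ := {z | z.re < b}
  have hX : AnalyticOnNhd ℂ (ProbabilityTheory.complexMGF id μ) U := fun z hz =>
    ProbabilityTheory.analyticAt_complexMGF (hsub hμ hz)
  have hY : AnalyticOnNhd ℂ (ProbabilityTheory.complexMGF id μ') U := fun z hz =>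
    ProbabilityTheory.analyticAt_complexMGF (hsub hμ' hz)
  have hfreq : ∃ᶠ z in 𝓝[≠] (0 : ℂ), ProbabilityTheory.complexMGF id μ z
      = ProbabilityTheory.complexMGF id μ' z := by
    have hreal : ∃ᶠ x : ℝ in 𝓝[≠] (0 : ℝ), ProbabilityTheory.complexMGF id μ x
        = ProbabilityTheory.complexMGF id μ' x := by
      refine Eventually.frequently ?_
      filter_upwards [nhdsWithin_le_nhds (Iio_mem_nhds hb)] with x hx
      rw [ProbabilityTheory.complexMGF_ofReal, ProbabilityTheory.complexMGF_ofReal]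
      exact congrArg _ (h x hx)
    refine Filter.Tendsto.frequently (f := fun x : ℝ => (x : ℂ)) ?_ hreal
    refine tendsto_nhdsWithin_iff.2 ⟨?_, ?_⟩
    · exact (Complex.continuous_ofReal.tendsto' 0 0 (by simp)).mono_left nhdsWithin_le_nhds
    · filter_upwards [self_mem_nhdsWithin] with x hx
      simpa using hx
  have hEq : EqOn (ProbabilityTheory.complexMGF id μ) (ProbabilityTheory.complexMGF id μ') U :=
    AnalyticOnNhd.eqOn_of_preconnected_of_frequently_eq hX hY
      (convex_halfSpace_re_lt b).isPreconnected (z₀ := 0) (by simpa [U] using hb) hfreq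
  refine Measure.ext_of_charFun (funext fun t => ?_)
  rw [← ProbabilityTheory.complexMGF_id_mul_I, ← ProbabilityTheory.complexMGF_id_mul_I]
  exact hEq (by simpa [U] using hb)

theorem ae_eq_of_laplace_eq {f g : ℝ → ℝ≥0∞} (hf : Measurable f) (hg : Measurable g)
    (hfin : ∀ l : ℝ, 0 < l → ∫⁻ x, ENNReal.ofReal (Real.exp (-l * x)) * f x ≠ ∞)
    (h : ∀ l : ℝ, 0 < l → ∫⁻ x, ENNReal.ofReal (Real.exp (-l * x)) * f x
      = ∫⁻ x, ENNReal.ofReal (Real.exp (-l * x)) * g x) : f =ᵐ[volume] g := by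
  let T : (ℝ → ℝ≥0∞) → Measure ℝ := fun u =>
    volume.withDensity (fun x => ENNReal.ofReal (Real.exp (-1 * x)) * u x)
  have hT : ∀ u : ℝ → ℝ≥0∞, Measurable u → ∀ z : ℝ,
      ∫⁻ x, ENNReal.ofReal (Real.exp (z * x)) ∂(T u)
        = ∫⁻ x, ENNReal.ofReal (Real.exp (-(1 - z) * x)) * u x := by
    intro u hu z
    rw [lintegral_withDensity_eq_lintegral_mul _ (by fun_prop) (by fun_prop)]
    refine lintegral_congr fun x => ?_
    simp only [Pi.mul_apply]
    rw [mul_right_comm, ← ENNReal.ofReal_mul (Real.exp_pos _).le, ← Real.exp_add]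
    ring_nf
  have hgfin : ∀ l : ℝ, 0 < l → ∫⁻ x, ENNReal.ofReal (Real.exp (-l * x)) * g x ≠ ∞ :=
    fun l hl => h l hl ▸ hfin l hl
  have hbase : ∀ u : ℝ → ℝ≥0∞, Measurable u →
      (∀ l : ℝ, 0 < l → ∫⁻ x, ENNReal.ofReal (Real.exp (-l * x)) * u x ≠ ∞) →
      ∀ z < (1 : ℝ), Integrable (fun x => Real.exp (z * x)) (T u) := by
    intro u hu hufin z hz
    refine ⟨by fun_prop, ?_⟩
    rw [hasFiniteIntegral_iff_ofReal (ae_of_all _ fun x => (Real.exp_pos _).le), hT u hu]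
    exact (hufin _ (by linarith)).lt_top
  have hfinm : ∀ u : ℝ → ℝ≥0∞, Measurable u →
      (∀ l : ℝ, 0 < l → ∫⁻ x, ENNReal.ofReal (Real.exp (-l * x)) * u x ≠ ∞) →
      IsFiniteMeasure (T u) := by
    intro u hu hufin
    refine ⟨?_⟩
    rw [withDensity_apply _ MeasurableSet.univ, setLIntegral_univ]
    exact (hufin 1 one_pos).lt_top
  have := hfinm f hf hfin
  have := hfinm g hg hgfin
  have hTfg : T f = T g := by
    refine measure_eq_of_mgf_eqOn one_pos (hbase f hf hfin) (hbase g hg hgfin) fun z hz => ?_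
    rw [integral_eq_lintegral_of_nonneg_ae (ae_of_all _ fun x => (Real.exp_pos _).le)
        (by fun_prop),
      integral_eq_lintegral_of_nonneg_ae (ae_of_all _ fun x => (Real.exp_pos _).le)
        (by fun_prop), hT f hf, hT g hg, h _ (by linarith)]
  have hae := (withDensity_eq_iff (by fun_prop) (by fun_prop) (hfin 1 one_pos)).1 hTfg
  filter_upwards [hae] with x hx
  refine (ENNReal.mul_right_inj ?_ ENNReal.ofReal_ne_top).1 hx
  exact (ENNReal.ofReal_pos.2 (Real.exp_pos _)).ne'

theorem lintegral_exp_mul_conv {P k : ℝ → ℝ≥0∞} (hP : Measurable P) (hk : Measurable k) (l : ℝ) :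
    ∫⁻ x, ENNReal.ofReal (Real.exp (-l * x)) * ∫⁻ y, P y * k (x - y)
      = (∫⁻ y, ENNReal.ofReal (Real.exp (-l * y)) * P y)
        * ∫⁻ x, ENNReal.ofReal (Real.exp (-l * x)) * k x := by
  calc _ = ∫⁻ x, ∫⁻ y, ENNReal.ofReal (Real.exp (-l * x)) * (P y * k (x - y)) := by
        refine lintegral_congr fun x => (lintegral_const_mul _ (by fun_prop)).symm
    _ = ∫⁻ y, ∫⁻ x, ENNReal.ofReal (Real.exp (-l * x)) * (P y * k (x - y)) :=
        lintegral_lintegral_swap (by fun_prop)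
    _ = ∫⁻ y, ENNReal.ofReal (Real.exp (-l * y)) * P y
          * ∫⁻ x, ENNReal.ofReal (Real.exp (-l * x)) * k x := by
        refine lintegral_congr fun y => ?_
        rw [← lintegral_const_mul _ (by fun_prop), ← lintegral_sub_right_eq_self
          (fun x => ENNReal.ofReal (Real.exp (-l * y)) * P y *
            (ENNReal.ofReal (Real.exp (-l * x)) * k x)) y]
        refine lintegral_congr fun x => ?_
        have : Real.exp (-l * x) = Real.exp (-l * y) * Real.exp (-l * (x - y)) := by
          rw [← Real.exp_add]; ring_nf
        rw [this, ENNReal.ofReal_mul (Real.exp_pos _).le]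
        ring
    _ = _ := lintegral_mul_const _ (by fun_prop)

theorem le_two_mul_of_size_bias_conv {p : ℝ → ℝ} (hp : Continuous p) (hp0 : ∀ t, 0 ≤ p t)
    {k : ℝ → ℝ≥0∞} (hk : Measurable k) (hk0 : ∀ x ≤ 0, k x = 0) (hanti : AntitoneOn k (Ioi 0))
    {r : ℝ}
    (hid : ∀ᵐ x : ℝ, 0 < x → ENNReal.ofReal (x * p x) = ENNReal.ofReal r *
      ∫⁻ y, (Ioi 0).indicator (fun y => ENNReal.ofReal (p y)) y * k (x - y))
    {a δ : ℝ} (ha : 0 < a) (hδ : 0 ≤ δ)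
    (hK : ENNReal.ofReal r * ∫⁻ u in Ioc 0 δ, k u ≤ ENNReal.ofReal (a / 2))
    {h : ℝ} (hh : h ∈ Icc 0 δ) : p (a + h) ≤ 2 * p a := by
  obtain ⟨s, hs, hmax⟩ := isCompact_Icc.exists_isMaxOn (s := Icc a (a + δ))
    (nonempty_Icc.2 (by linarith)) hp.continuousOn
  have hmax' : ∀ y ∈ Icc a (a + δ), p y ≤ p s := fun y hy => hmax hy
  -- the increments of the density, weighted by the location, are controlled on the full-measure set
  have hdense := Measure.dense_of_ae hid
  have hincr : ∀ t t' : ℝ, (0 < t → ENNReal.ofReal (t * p t) = ENNReal.ofReal r *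
        ∫⁻ y, (Ioi 0).indicator (fun y => ENNReal.ofReal (p y)) y * k (t - y)) →
      (0 < t' → ENNReal.ofReal (t' * p t') = ENNReal.ofReal r *
        ∫⁻ y, (Ioi 0).indicator (fun y => ENNReal.ofReal (p y)) y * k (t' - y)) →
      a < t → t < t' → t' < a + δ → t' * p t' ≤ t * p t + a / 2 * p s := by
    intro t t' ht ht' hat htt' ht'a
    have ht0 : 0 < t := ha.trans hat
    have ht'0 : 0 < t' := ht0.trans htt'
    set P : ℝ → ℝ≥0∞ := (Ioi 0).indicator (fun y => ENNReal.ofReal (p y)) with hPdef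
    have hPm : Measurable P := (hp.measurable.ennreal_ofReal).indicator measurableSet_Ioi
    have hpt : ∀ y, P y * k (t' - y) ≤ P y * k (t - y)
        + ENNReal.ofReal (p s) * (Ioc 0 δ).indicator k (t' - y) := by
      intro y
      rcases lt_or_ge y t with hy | hy
      · refine le_add_right (mul_le_mul_right ?_ _)
        exact hanti (mem_Ioi.2 (by linarith)) (mem_Ioi.2 (by linarith)) (by linarith)
      rcases lt_or_ge y t' with hy' | hy'
      · refine le_add_left ?_
        rw [indicator_of_mem (by constructor <;> linarith), hPdef,
          indicator_of_mem (mem_Ioi.2 (by linarith))]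
        gcongr
        exact hmax' y ⟨by linarith, by linarith⟩
      · rw [hk0 (t' - y) (by linarith)]
        simp
    have hbase : ∫⁻ y, P y * k (t' - y) ≤ (∫⁻ y, P y * k (t - y))
        + ENNReal.ofReal (p s) * ∫⁻ u in Ioc 0 δ, k u := by
      refine (lintegral_mono hpt).trans (le_of_eq ?_)
      have hm : Measurable ((Ioc 0 δ).indicator k) := hk.indicator measurableSet_Ioc
      rw [lintegral_add_left (by fun_prop), lintegral_const_mul _ (by fun_prop),
        lintegral_sub_left_eq_self (fun u => (Ioc 0 δ).indicator k u) t',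
        lintegral_indicator measurableSet_Ioc]
    have hE : ENNReal.ofReal (t' * p t') ≤ ENNReal.ofReal (t * p t + a / 2 * p s) := by
      rw [ht' ht'0, ENNReal.ofReal_add (mul_nonneg ht0.le (hp0 t))
        (mul_nonneg (by linarith) (hp0 s)), ht ht0, ENNReal.ofReal_mul (by linarith)]
      calc _ ≤ ENNReal.ofReal r * ((∫⁻ y, P y * k (t - y))
            + ENNReal.ofReal (p s) * ∫⁻ u in Ioc 0 δ, k u) := by gcongr
        _ = ENNReal.ofReal r * (∫⁻ y, P y * k (t - y))
            + (ENNReal.ofReal r * ∫⁻ u in Ioc 0 δ, k u) * ENNReal.ofReal (p s) := by ring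
        _ ≤ _ := by gcongr
    exact (ENNReal.ofReal_le_ofReal_iff (add_nonneg (mul_nonneg ht0.le (hp0 t))
      (mul_nonneg (by linarith) (hp0 s)))).1 hE
  have hkey : s * p s ≤ a * p a + a / 2 * p s := by
    by_contra! hcon
    have hlt : a < s := by
      refine lt_of_le_of_ne hs.1 fun hne => ?_
      rw [← hne] at hcon
      nlinarith [hp0 a]
    have hf : Continuous fun x => x * p x := continuous_id.mul hp
    obtain ⟨m, hm1, hm2⟩ := exists_between hcon
    have h1 : ∀ᶠ x in 𝓝[>] a, x * p x < m - a / 2 * p s :=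
      nhdsWithin_le_nhds (hf.continuousAt.eventually_lt continuousAt_const (by linarith))
    have h2 : ∀ᶠ y in 𝓝[<] s, m < y * p y :=
      nhdsWithin_le_nhds (continuousAt_const.eventually_lt hf.continuousAt hm2)
    obtain ⟨b, hb, hbU⟩ := mem_nhdsGT_iff_exists_Ioo_subset.1 h1
    obtain ⟨c, hc, hcU⟩ := mem_nhdsLT_iff_exists_Ioo_subset.1 h2
    obtain ⟨x, hxG, hx⟩ := hdense.exists_between (lt_min hb (show a < (a + s) / 2 by linarith))
    obtain ⟨y, hyG, hy⟩ := hdense.exists_between (max_lt hc (show (a + s) / 2 < s by linarith))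
    have hx2 := lt_min_iff.1 hx.2
    have hy1 := max_lt_iff.1 hy.1
    have hxm : x * p x < m - a / 2 * p s := hbU ⟨hx.1, hx2.1⟩
    have hym : m < y * p y := hcU ⟨hy1.1, hy.2⟩
    have := hincr x y hxG hyG hx.1 (hx2.2.trans hy1.2) (hy.2.trans_le hs.2)
    linarith
  have hps : p s ≤ 2 * p a := by
    have : a * p s ≤ s * p s := mul_le_mul_of_nonneg_right hs.1 (hp0 s)
    have : a * p s ≤ a * (2 * p a) := by linarith
    exact le_of_mul_le_mul_left this ha
  exact (hmax' _ ⟨by linarith [hh.1], by linarith [hh.2]⟩).trans hps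

theorem mul_exp_neg_mul_le_inv {l : ℝ} (hl : 0 < l) (x : ℝ) : x * Real.exp (-l * x) ≤ l⁻¹ := by
  have h1 : l * x ≤ Real.exp (l * x) := by linarith [Real.add_one_le_exp (l * x)]
  have h2 : Real.exp (l * x) * Real.exp (-l * x) = 1 := by rw [← Real.exp_add]; simp
  rw [← one_div, le_div_iff₀ hl]
  nlinarith [Real.exp_pos (-l * x)]

section Bernstein

variable {ν : Measure ℝ}

theorem integrable_min_one (hν : ∫⁻ x in Ioi (0:ℝ), ENNReal.ofReal (min 1 x) ∂ν ≠ ⊤) :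
    Integrable (fun x : ℝ => min 1 x) (ν.restrict (Ioi 0)) := by
  refine ⟨by fun_prop, ?_⟩
  rw [hasFiniteIntegral_iff_ofReal]
  · exact hν.lt_top
  · filter_upwards [ae_restrict_mem measurableSet_Ioi] with x hx
    exact le_min zero_le_one (le_of_lt hx)

theorem integrable_one_sub_exp (hν : ∫⁻ x in Ioi (0:ℝ), ENNReal.ofReal (min 1 x) ∂ν ≠ ⊤)
    {l : ℝ} (hl : 0 < l) :
    Integrable (fun x : ℝ => 1 - Real.exp (-l * x)) (ν.restrict (Ioi 0)) := by
  refine ((integrable_min_one hν).const_mul (max 1 l)).mono' (by fun_prop) ?_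
  filter_upwards [ae_restrict_mem measurableSet_Ioi] with x hx
  have hx : 0 < x := hx
  have h1 : Real.exp (-l * x) ≤ 1 := Real.exp_le_one_iff.2 (by nlinarith)
  rw [Real.norm_of_nonneg (by linarith)]
  rcases le_total 1 x with h | h
  · rw [min_eq_left h]
    linarith [le_max_left 1 l, Real.exp_pos (-l * x)]
  · rw [min_eq_right h]
    have := Real.add_one_le_exp (-l * x)
    nlinarith [le_max_right 1 l]

theorem integrable_mul_exp (hν : ∫⁻ x in Ioi (0:ℝ), ENNReal.ofReal (min 1 x) ∂ν ≠ ⊤)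
    {l : ℝ} (hl : 0 < l) :
    Integrable (fun x : ℝ => x * Real.exp (-l * x)) (ν.restrict (Ioi 0)) := by
  refine ((integrable_min_one hν).const_mul (max 1 l⁻¹)).mono' (by fun_prop) ?_
  filter_upwards [ae_restrict_mem measurableSet_Ioi] with x hx
  have hx : 0 < x := hx
  have h1 : Real.exp (-l * x) ≤ 1 := Real.exp_le_one_iff.2 (by nlinarith)
  rw [Real.norm_of_nonneg (by positivity)]
  rcases le_total 1 x with h | h
  · rw [min_eq_left h]
    linarith [le_max_right 1 l⁻¹, mul_exp_neg_mul_le_inv hl x]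
  · rw [min_eq_right h]
    nlinarith [le_max_left 1 l⁻¹]

theorem hasDerivAt_integral_one_sub_exp
    (hν : ∫⁻ x in Ioi (0:ℝ), ENNReal.ofReal (min 1 x) ∂ν ≠ ⊤) {l : ℝ} (hl : 0 < l) :
    HasDerivAt (fun s => ∫ x in Ioi (0:ℝ), (1 - Real.exp (-s * x)) ∂ν)
      (∫ x in Ioi (0:ℝ), x * Real.exp (-l * x) ∂ν) l := by
  refine (hasDerivAt_integral_of_dominated_loc_of_deriv_le (s := Ioi (l / 2))
    (F' := fun s x => x * Real.exp (-s * x)) (bound := fun x => x * Real.exp (-(l / 2) * x))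
    (Ioi_mem_nhds (by linarith)) (Eventually.of_forall fun s => by fun_prop)
    (integrable_one_sub_exp hν hl) (by fun_prop) ?_ (integrable_mul_exp hν (by linarith)) ?_).2
  · filter_upwards [ae_restrict_mem measurableSet_Ioi] with x hx s hs
    have hx : 0 < x := hx
    have hs : l / 2 < s := hs
    rw [Real.norm_of_nonneg (by positivity)]
    gcongr
  · refine ae_of_all _ fun x s _ => ?_
    have := (((hasDerivAt_neg s).mul_const x).exp).const_sub 1
    convert this using 1
    ring

theorem sub_mul_integral_mul_exp_le
    (hν : ∫⁻ x in Ioi (0:ℝ), ENNReal.ofReal (min 1 x) ∂ν ≠ ⊤) {u s : ℝ} (hu : 0 < u)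
    (hus : u ≤ s) :
    (s - u) * ∫ x in Ioi (0:ℝ), x * Real.exp (-s * x) ∂ν
      ≤ (∫ x in Ioi (0:ℝ), (1 - Real.exp (-s * x)) ∂ν)
        - ∫ x in Ioi (0:ℝ), (1 - Real.exp (-u * x)) ∂ν := by
  have hs := hu.trans_le hus
  rw [← integral_const_mul, ← integral_sub (integrable_one_sub_exp hν hs)
    (integrable_one_sub_exp hν hu)]
  refine integral_mono ((integrable_mul_exp hν hs).const_mul _)
    ((integrable_one_sub_exp hν hs).sub (integrable_one_sub_exp hν hu)) fun x => ?_
  have h1 := Real.add_one_le_exp ((s - u) * x)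
  have h2 : Real.exp (-u * x) = Real.exp (-s * x) * Real.exp ((s - u) * x) := by
    rw [← Real.exp_add]; ring_nf
  have := Real.exp_pos (-s * x)
  simp only [h2]
  nlinarith

theorem integral_sub_le_sub_mul_integral
    (hν : ∫⁻ x in Ioi (0:ℝ), ENNReal.ofReal (min 1 x) ∂ν ≠ ⊤) {u s : ℝ} (hu : 0 < u)
    (hus : u ≤ s) :
    (∫ x in Ioi (0:ℝ), (1 - Real.exp (-s * x)) ∂ν)
        - (∫ x in Ioi (0:ℝ), (1 - Real.exp (-u * x)) ∂ν)
      ≤ (s - u) * ∫ x in Ioi (0:ℝ), x * Real.exp (-u * x) ∂ν := by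
  have hs := hu.trans_le hus
  rw [← integral_const_mul, ← integral_sub (integrable_one_sub_exp hν hs)
    (integrable_one_sub_exp hν hu)]
  refine integral_mono ((integrable_one_sub_exp hν hs).sub (integrable_one_sub_exp hν hu))
    ((integrable_mul_exp hν hu).const_mul _) fun x => ?_
  have h1 := Real.add_one_le_exp (-(s - u) * x)
  have h2 : Real.exp (-s * x) = Real.exp (-u * x) * Real.exp (-(s - u) * x) := by
    rw [← Real.exp_add]; ring_nf
  have := Real.exp_pos (-u * x)
  simp only [h2]
  nlinarith

theorem mul_integral_mul_exp_le
    (hν : ∫⁻ x in Ioi (0:ℝ), ENNReal.ofReal (min 1 x) ∂ν ≠ ⊤) {s : ℝ} (hs : 0 < s) :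
    s * ∫ x in Ioi (0:ℝ), x * Real.exp (-s * x) ∂ν
      ≤ ∫ x in Ioi (0:ℝ), (1 - Real.exp (-s * x)) ∂ν := by
  rw [← integral_const_mul]
  refine integral_mono ((integrable_mul_exp hν hs).const_mul _)
    (integrable_one_sub_exp hν hs) fun x => ?_
  have h1 := Real.add_one_le_exp (s * x)
  have h2 : Real.exp (-s * x) * Real.exp (s * x) = 1 := by
    rw [← Real.exp_add]; simp
  have := Real.exp_pos (-s * x)
  simp only
  nlinarith

end Bernstein

section Subordinator

variable {μ : Measure ℝ} [IsProbabilityMeasure μ]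

theorem integrable_exp_neg_mul (hμ : ∀ᵐ x ∂μ, 0 ≤ x) {l : ℝ} (hl : 0 ≤ l) :
    Integrable (fun x => Real.exp (-l * x)) μ := by
  refine Integrable.of_bound (by fun_prop) 1 ?_
  filter_upwards [hμ] with x hx
  rw [Real.norm_of_nonneg (Real.exp_pos _).le]
  exact Real.exp_le_one_iff.2 (by nlinarith)

theorem integral_mul_exp_eq (hμ : ∀ᵐ x ∂μ, 0 ≤ x) {φ : ℝ → ℝ} {r : ℝ}
    (hlap : ∀ l : ℝ, 0 < l → ∫ s, Real.exp (-l * s) ∂μ = Real.exp (-r * φ l))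
    {l φ' : ℝ} (hl : 0 < l) (hφ : HasDerivAt φ φ' l) :
    Integrable (fun x => x * Real.exp (-l * x)) μ ∧
      ∫ x, x * Real.exp (-l * x) ∂μ = r * φ' * Real.exp (-r * φ l) := by
  have h := hasDerivAt_integral_of_dominated_loc_of_deriv_le (μ := μ) (x₀ := l)
    (F := fun s x => Real.exp (-s * x))
    (s := Ioi (l / 2))
    (F' := fun s x => -(x * Real.exp (-s * x))) (bound := fun _ => (l / 2)⁻¹)
    (Ioi_mem_nhds (by linarith)) (Eventually.of_forall fun s => by fun_prop)
    (integrable_exp_neg_mul hμ hl.le) (by fun_prop) ?_ (integrable_const _) ?_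
  · refine ⟨by simpa using h.1.neg, ?_⟩
    have h2 : HasDerivAt (fun s => ∫ x, Real.exp (-s * x) ∂μ)
        (Real.exp (-r * φ l) * (-r * φ')) l := by
      refine ((hφ.const_mul (-r)).exp).congr_of_eventuallyEq ?_
      filter_upwards [Ioi_mem_nhds hl] with s hs using hlap s hs
    have h3 := h.2.unique h2
    rw [integral_neg] at h3
    linarith
  · filter_upwards [hμ] with x hx s hs
    have hs : l / 2 < s := hs
    rw [norm_neg, Real.norm_of_nonneg (by positivity)]
    refine (mul_exp_neg_mul_le_inv (by linarith) x).trans ?_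
    gcongr
  · refine ae_of_all _ fun x s _ => ?_
    have := ((hasDerivAt_neg s).mul_const x).exp
    rw [show Real.exp (-s * x) * (-1 * x) = -(x * Real.exp (-s * x)) by ring] at this
    exact this

theorem measureReal_Iic_le (hμ : ∀ᵐ x ∂μ, 0 ≤ x) {l : ℝ} (hl : 0 ≤ l) (t : ℝ) :
    μ.real (Iic t) ≤ Real.exp (l * t) * ∫ s, Real.exp (-l * s) ∂μ := by
  have := ProbabilityTheory.measure_le_le_exp_mul_mgf (X := id) (μ := μ) (t := -l) t (by linarith)
    (integrable_exp_neg_mul hμ hl)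
  simpa [ProbabilityTheory.mgf, Iic_def] using this

theorem measureReal_Icc_ge (hμ : ∀ᵐ x ∂μ, 0 ≤ x) {l t M : ℝ} (hl : 0 < l) (hM : 0 < M)
    (hbase : Integrable (fun x => x * Real.exp (-l * x)) μ) :
    (∫ x, Real.exp (-l * x) ∂μ) - Real.exp (l * t) * (∫ x, Real.exp (-(2 * l) * x) ∂μ)
      - M⁻¹ * ∫ x, x * Real.exp (-l * x) ∂μ ≤ μ.real (Icc t M) := by
  have h1 := integrable_exp_neg_mul hμ hl.le
  have h2 := integrable_exp_neg_mul hμ (l := 2 * l) (by linarith)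
  rw [← integral_const_mul, ← integral_const_mul, ← integral_sub h1 (h2.const_mul _),
    ← integral_sub (f := fun x => Real.exp (-l * x) - Real.exp (l * t) * Real.exp (-(2 * l) * x))
      (h1.sub (h2.const_mul _)) (hbase.const_mul _),
    ← integral_indicator_one measurableSet_Icc]
  refine integral_mono_ae ((h1.sub (h2.const_mul _)).sub (hbase.const_mul _))
    ((integrable_const 1).indicator measurableSet_Icc) ?_
  filter_upwards [hμ] with x hx
  have e2 : Real.exp (l * t) * Real.exp (-(2 * l) * x)
      = Real.exp (-l * x) * Real.exp (l * (t - x)) := by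
    rw [← Real.exp_add, ← Real.exp_add]; ring_nf
  have hp := Real.exp_pos (-l * x)
  have hp2 := Real.exp_pos (l * (t - x))
  have hMx : 0 ≤ M⁻¹ * (x * Real.exp (-l * x)) := by positivity
  simp only [e2]
  by_cases hxm : x ∈ Icc t M
  · rw [indicator_of_mem hxm]
    have : Real.exp (-l * x) ≤ 1 := Real.exp_le_one_iff.2 (by nlinarith)
    simp only [Pi.one_apply]
    nlinarith [mul_pos hp hp2]
  · rw [indicator_of_notMem hxm]
    rcases lt_or_ge x t with hxt | hxt
    · have : 1 ≤ Real.exp (l * (t - x)) := Real.one_le_exp (by nlinarith)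
      nlinarith
    · have hMx' : M < x := by
        by_contra! hc
        exact hxm ⟨hxt, hc⟩
      have : 1 ≤ M⁻¹ * x := by
        rw [inv_mul_eq_div, one_le_div hM]; exact hMx'.le
      nlinarith [mul_pos hp hp2]

end Subordinator

theorem exists_mul_le_of_upper_scaling {φ : ℝ → ℝ} {β c : ℝ} (hβ : β < 1) (hc : 0 < c)
    (hpos : ∀ s, 0 < s → 0 < φ s)
    (hscale : ∀ l : ℝ, 0 < l → ∀ κ : ℝ, 1 ≤ κ → φ (κ * l) / φ l ≤ c * κ ^ β)
    {ε : ℝ} (hε : 0 < ε) :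
    ∃ x₀, 0 < x₀ ∧ x₀ ≤ 1 ∧ ∀ x, 0 < x → x ≤ x₀ → ∀ s, 0 < s → x * φ s ≤ ε * φ (x * s) := by
  have hβ' : 0 < 1 - β := by linarith
  have hεc : 0 < ε / c := by positivity
  refine ⟨min 1 ((ε / c) ^ (1 - β)⁻¹), by positivity, min_le_left _ _, fun x hx hx0 s hs => ?_⟩
  have hx1 : x ≤ 1 := hx0.trans (min_le_left _ _)
  have hpow : x ^ (1 - β) ≤ ε / c := by
    calc x ^ (1 - β) ≤ ((ε / c) ^ (1 - β)⁻¹) ^ (1 - β) :=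
          Real.rpow_le_rpow hx.le (hx0.trans (min_le_right _ _)) hβ'.le
      _ = ε / c := Real.rpow_inv_rpow hεc.le hβ'.ne'
  have h := hscale (x * s) (by positivity) x⁻¹ ((one_le_inv₀ hx).2 hx1)
  rw [inv_mul_cancel_left₀ hx.ne', div_le_iff₀ (hpos _ (by positivity)), Real.inv_rpow hx.le,
    ← Real.rpow_neg hx.le] at h
  have hxx : x * x ^ (-β) = x ^ (1 - β) := by
    rw [sub_eq_add_neg, Real.rpow_add hx, Real.rpow_one]
  calc x * φ s ≤ x * (c * x ^ (-β) * φ (x * s)) := by gcongr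
    _ = c * (x * x ^ (-β)) * φ (x * s) := by ring
    _ ≤ c * (ε / c) * φ (x * s) := by
        have := (hpos (x * s) (by positivity)).le
        rw [hxx]
        gcongr
    _ = ε * φ (x * s) := by field_simp

theorem sInf_derivative_le_bounds {φ φd : ℝ → ℝ} {D : ℝ} (hD : 0 < D)
    (hpos : ∀ s, 0 < s → 0 < φ s) (hanti : ∀ u s, 0 < u → u ≤ s → φd s ≤ φd u)
    (hle : ∀ s, 0 < s → s * φd s ≤ φ s) (hge : ∀ s, 0 < s → φ s ≤ D * (s * φd s))
    (hsub : ∀ ε, 0 < ε → ∃ x₀, 0 < x₀ ∧ x₀ ≤ 1 ∧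
      ∀ x, 0 < x → x ≤ x₀ → ∀ s, 0 < s → x * φ s ≤ ε * φ (x * s))
    {l : ℝ} (hl : 0 < l) :
    0 < sInf {s : ℝ | 0 < s ∧ φd s ≤ l} ∧ φd (2 * sInf {s : ℝ | 0 < s ∧ φd s ≤ l}) ≤ l ∧
      l ≤ φd (sInf {s : ℝ | 0 < s ∧ φd s ≤ l} / 2) := by
  set S := {s : ℝ | 0 < s ∧ φd s ≤ l} with hS
  have h1 := hpos 1 one_pos
  have hne : S.Nonempty := by
    obtain ⟨x, hx, -, h⟩ := hsub (l / φ 1) (by positivity)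
    have h2 := h x hx le_rfl x⁻¹ (by positivity)
    rw [mul_inv_cancel₀ hx.ne', div_mul_cancel₀ _ h1.ne'] at h2
    have h3 := hle x⁻¹ (by positivity)
    refine ⟨x⁻¹, by positivity, le_trans ?_ h2⟩
    calc φd x⁻¹ = x * (x⁻¹ * φd x⁻¹) := by field_simp
      _ ≤ x * φ x⁻¹ := by gcongr
  have hbdd : BddBelow S := ⟨0, fun s hs => hs.1.le⟩
  have hw : 0 < sInf S := by
    obtain ⟨x, hx, -, h⟩ := hsub (φ 1 / (2 * l * D)) (by positivity)
    refine hx.trans_le (le_csInf hne fun s hs => ?_)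
    by_contra! hsx
    have h2 := h s hs.1 hsx.le 1 one_pos
    rw [mul_one] at h2
    have h3 : s * φ 1 ≤ φ 1 / (2 * l * D) * (D * (s * l)) :=
      h2.trans (by
        have := hge s hs.1
        have h4 : D * (s * φd s) ≤ D * (s * l) := by
          have := hs.1.le
          gcongr
          exact hs.2
        gcongr
        linarith)
    have h4 : φ 1 / (2 * l * D) * (D * (s * l)) = s * φ 1 / 2 := by field_simp
    have := mul_pos hs.1 h1
    linarith
  refine ⟨hw, ?_, ?_⟩
  · obtain ⟨s, hs, hs2⟩ := exists_lt_of_csInf_lt hne (show sInf S < 2 * sInf S by linarith)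
    exact (hanti s _ hs.1 hs2.le).trans hs.2
  · by_contra! h
    have : sInf S ≤ sInf S / 2 := csInf_le hbdd ⟨by linarith, h.le⟩
    linarith

theorem le_two_pow_mul_of_doubling {p : ℝ → ℝ} {t δ : ℝ} (hδ : 0 ≤ δ)
    (h : ∀ a, t ≤ a → ∀ u ∈ Icc 0 δ, p (a + u) ≤ 2 * p a) (n : ℕ) :
    ∀ u ∈ Icc 0 (n * δ), p (t + u) ≤ 2 ^ n * p t := by
  induction n with
  | zero =>
    intro u hu
    have : u = 0 := by
      have := hu.2
      simp only [Nat.cast_zero, zero_mul] at this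
      exact le_antisymm this hu.1
    simp [this]
  | succ n ih =>
    intro u hu
    have hu2 := hu.2
    push_cast at hu2
    have hn : 0 ≤ (n : ℝ) * δ := by positivity
    set v := min u (n * δ) with hv
    have hv1 : v ≤ u := min_le_left _ _
    have hv0 : 0 ≤ v := le_min hu.1 hn
    have h1 := ih v ⟨hv0, min_le_right _ _⟩
    have h2 := h (t + v) (by linarith) (u - v) ⟨by linarith, by
      rcases min_cases u (n * δ) with hc | hc <;> rw [hv] <;> linarith⟩
    rw [show t + v + (u - v) = t + u by ring] at h2
    calc p (t + u) ≤ 2 * p (t + v) := h2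
      _ ≤ 2 * (2 ^ n * p t) := by gcongr
      _ = 2 ^ (n + 1) * p t := by ring

theorem density_upper_bound_of_doubling {p : ℝ → ℝ} {m : ℝ → ℝ → ℝ}
    (hm : ∀ a b c, 0 ≤ a → a ≤ b → (∀ x ∈ Icc a b, c ≤ p x) → (b - a) * c ≤ m a b)
    {t w B θ : ℝ} (ht : 0 < t) (hw : 0 < w) (hB : 0 < B) (hθ : 0 < θ) (hBt : 2 ≤ B * w * t)
    (hdoub : ∀ a, t / 2 ≤ a → ∀ u ∈ Icc 0 (B * w)⁻¹, p (a + u) ≤ 2 * p a)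
    (htail : ∀ a, m a t ≤ Real.exp (-(θ * (w * t)))) :
    p t ≤ (4 * B / θ) / t * Real.exp (-(θ / 2 * (t * w))) := by
  set δ := (B * w)⁻¹ with hδ
  have hδ0 : 0 < δ := by positivity
  have hδt : δ ≤ t / 2 := by
    rw [hδ, inv_le_comm₀ (by positivity) (by positivity), inv_div, div_le_iff₀ ht]
    exact hBt
  have h1 := hm (t - δ) t (p t / 2) (by linarith) (by linarith) fun x hx => by
    have := hdoub x (by linarith [hx.1]) (t - x) ⟨by linarith [hx.2], by linarith [hx.1]⟩
    rw [add_sub_cancel] at this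
    linarith
  have h2 : δ * (p t / 2) ≤ Real.exp (-(θ * (w * t))) := by
    simpa using h1.trans (htail _)
  have h3 : p t ≤ 2 * (B * w) * Real.exp (-(θ * (w * t))) := by
    have : p t = 2 * (B * w) * (δ * (p t / 2)) := by rw [hδ]; field_simp
    rw [this]
    gcongr
  have h4 : θ / 2 * (t * w) ≤ Real.exp (θ / 2 * (t * w)) := by
    linarith [Real.add_one_le_exp (θ / 2 * (t * w))]
  have h5 : Real.exp (-(θ * (w * t))) = Real.exp (-(θ / 2 * (t * w)))
      * Real.exp (-(θ / 2 * (t * w))) := by rw [← Real.exp_add]; ring_nf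
  have h6 : Real.exp (θ / 2 * (t * w)) * Real.exp (-(θ / 2 * (t * w))) = 1 := by
    rw [← Real.exp_add]; simp
  have h7 : θ / 2 * (t * w) * Real.exp (-(θ / 2 * (t * w))) ≤ 1 := by
    rw [← h6]; gcongr
  calc p t ≤ 2 * (B * w) * Real.exp (-(θ * (w * t))) := h3
    _ = (4 * B / θ) / t * (θ / 2 * (t * w) * Real.exp (-(θ / 2 * (t * w))))
        * Real.exp (-(θ / 2 * (t * w))) := by rw [h5]; field_simp; ring
    _ ≤ (4 * B / θ) / t * 1 * Real.exp (-(θ / 2 * (t * w))) := by gcongr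
    _ = _ := by rw [mul_one]

theorem density_lower_bound_of_doubling {p : ℝ → ℝ} (hp : ∀ x, 0 ≤ p x) {t w B M : ℝ} {m : ℝ}
    (hm : ∀ c, (∀ x ∈ Icc t (M * t), p x ≤ c) → m ≤ (M * t - t) * c)
    (ht : 0 < t) (hw : 0 < w) (hB : 0 < B) (hM : 1 ≤ M)
    (hdoub : ∀ a, t ≤ a → ∀ u ∈ Icc 0 (B * w)⁻¹, p (a + u) ≤ 2 * p a) :
    m / (M * Real.exp 1 * t) * Real.exp (-(M * B * (t * w))) ≤ p t := by
  set n := ⌈M * t * (B * w)⌉₊ with hn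
  have hδ0 : 0 < (B * w)⁻¹ := by positivity
  have hn1 : M * t * (B * w) ≤ n := Nat.le_ceil _
  have hn2 : (n : ℝ) ≤ M * t * (B * w) + 1 := (Nat.ceil_lt_add_one (by positivity)).le
  have hnδ : M * t ≤ n * (B * w)⁻¹ := by
    rw [← div_eq_mul_inv, le_div_iff₀ (by positivity)]; exact hn1
  have h1 := hm (2 ^ n * p t) fun x hx => by
    have := le_two_pow_mul_of_doubling hδ0.le hdoub n (x - t)
      ⟨by linarith [hx.1], by linarith [hx.2]⟩
    rwa [add_sub_cancel] at this
  have h2 : (2 : ℝ) ^ n ≤ Real.exp 1 * Real.exp (M * B * (t * w)) := by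
    calc (2 : ℝ) ^ n ≤ Real.exp 1 ^ n := by
          gcongr
          linarith [Real.add_one_le_exp 1]
      _ = Real.exp n := by rw [← Real.exp_nat_mul, mul_one]
      _ ≤ Real.exp (1 + M * B * (t * w)) := by gcongr; linarith
      _ = _ := Real.exp_add _ _
  have h3 : m ≤ M * t * (Real.exp 1 * Real.exp (M * B * (t * w)) * p t) := by
    have := hp t
    refine h1.trans ?_
    gcongr
    linarith
  have h4 : Real.exp (M * B * (t * w)) * Real.exp (-(M * B * (t * w))) = 1 := by
    rw [← Real.exp_add]; simp
  calc _ ≤ M * t * (Real.exp 1 * Real.exp (M * B * (t * w)) * p t) / (M * Real.exp 1 * t)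
        * Real.exp (-(M * B * (t * w))) := by gcongr
    _ = p t * (Real.exp (M * B * (t * w)) * Real.exp (-(M * B * (t * w)))) := by field_simp
    _ = p t := by rw [h4, mul_one]

theorem eq_withDensity_indicator {μ : Measure ℝ} {f : ℝ → ℝ≥0∞} {S : Set ℝ} (hS : S =ᵐ[volume] Ioi 0)
    (h : ∀ A : Set ℝ, MeasurableSet A → μ A = ∫⁻ x in A ∩ S, f x) :
    μ = volume.withDensity ((Ioi 0).indicator f) := by
  ext A hA
  rw [h A hA, withDensity_apply _ hA, setLIntegral_indicator measurableSet_Ioi, inter_comm _ A]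
  exact setLIntegral_congr ((ae_eq_refl A).inter hS)

theorem ofReal_mul_density_eq_conv {ν μ : Measure ℝ} [IsProbabilityMeasure μ]
    (hν : ∫⁻ x in Ioi (0:ℝ), ENNReal.ofReal (min 1 x) ∂ν ≠ ⊤)
    {φ φd νd p : ℝ → ℝ} {r : ℝ} (hr : 0 < r)
    (hφ : ∀ l, 0 < l → HasDerivAt φ (φd l) l)
    (hφd : ∀ l : ℝ, 0 < l → φd l = ∫ x in Ioi (0:ℝ), x * Real.exp (-l * x) ∂ν)
    (hνd : Measurable νd) (hνd_nn : ∀ t, 0 ≤ νd t)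
    (hν_dens : ν = volume.withDensity ((Ioi 0).indicator fun x => ENNReal.ofReal (νd x)))
    (hp : Measurable p)
    (hlap : ∀ l : ℝ, 0 < l → ∫ s, Real.exp (-l * s) ∂μ = Real.exp (-r * φ l))
    (hμ_dens : μ = volume.withDensity ((Ioi 0).indicator fun x => ENNReal.ofReal (p x))) :
    ∀ᵐ x : ℝ, 0 < x → ENNReal.ofReal (x * p x) = ENNReal.ofReal r *
      ∫⁻ y, (Ioi 0).indicator (fun y => ENNReal.ofReal (p y)) y *
        (Ioi 0).indicator (fun y => ENNReal.ofReal (y * νd y)) (x - y) := by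
  set P : ℝ → ℝ≥0∞ := (Ioi 0).indicator fun y => ENNReal.ofReal (p y) with hP
  set k : ℝ → ℝ≥0∞ := (Ioi 0).indicator fun y => ENNReal.ofReal (y * νd y) with hk
  have hPm : Measurable P := hp.ennreal_ofReal.indicator measurableSet_Ioi
  have hkm : Measurable k := (measurable_id.mul hνd).ennreal_ofReal.indicator measurableSet_Ioi
  have hμ0 : ∀ᵐ x ∂μ, 0 ≤ x := by
    rw [hμ_dens, ae_withDensity_iff hPm]
    refine ae_of_all _ fun x hx => ?_
    by_contra! hc
    exact hx (indicator_of_notMem (by simpa using hc.le) _)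
  have hLP : ∀ l : ℝ, 0 < l →
      ∫⁻ y, ENNReal.ofReal (Real.exp (-l * y)) * P y = ENNReal.ofReal (Real.exp (-r * φ l)) := by
    intro l hl
    rw [← hlap l hl, ofReal_integral_eq_lintegral_ofReal (integrable_exp_neg_mul hμ0 hl.le)
      (ae_of_all _ fun x => (Real.exp_pos _).le), hμ_dens,
      lintegral_withDensity_eq_lintegral_mul _ hPm (by fun_prop)]
    refine lintegral_congr fun y => mul_comm _ _
  have hLX : ∀ l : ℝ, 0 < l →
      ∫⁻ y, ENNReal.ofReal (Real.exp (-l * y)) * (ENNReal.ofReal y * P y)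
        = ENNReal.ofReal (r * φd l * Real.exp (-r * φ l)) := by
    intro l hl
    obtain ⟨hi, he⟩ := integral_mul_exp_eq hμ0 hlap hl (hφ l hl)
    rw [← he, ofReal_integral_eq_lintegral_ofReal hi (by
      filter_upwards [hμ0] with x hx
      exact mul_nonneg hx (Real.exp_pos _).le), hμ_dens,
      lintegral_withDensity_eq_lintegral_mul _ hPm (by fun_prop)]
    refine lintegral_congr fun y => ?_
    rw [Pi.mul_apply, ENNReal.ofReal_mul' (Real.exp_pos _).le]
    ring
  have hLk : ∀ l : ℝ, 0 < l →
      ∫⁻ y, ENNReal.ofReal (Real.exp (-l * y)) * k y = ENNReal.ofReal (φd l) := by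
    intro l hl
    rw [hφd l hl, ofReal_integral_eq_lintegral_ofReal (integrable_mul_exp hν hl) (by
      filter_upwards [ae_restrict_mem measurableSet_Ioi] with x hx
      exact mul_nonneg (le_of_lt hx) (Real.exp_pos _).le), hν_dens,
      setLIntegral_withDensity_eq_setLIntegral_mul _
        (hνd.ennreal_ofReal.indicator measurableSet_Ioi) (by fun_prop) measurableSet_Ioi,
      ← lintegral_indicator measurableSet_Ioi]
    refine lintegral_congr fun y => ?_
    by_cases hy : y ∈ Ioi 0
    · simp only [hk, indicator_of_mem hy, Pi.mul_apply]
      rw [← ENNReal.ofReal_mul (Real.exp_pos _).le, ← ENNReal.ofReal_mul (hνd_nn y)]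
      ring_nf
    · simp [hk, indicator_of_notMem hy]
  have hφd0 : ∀ l, 0 < l → 0 ≤ φd l := fun l hl => by
    rw [hφd l hl]
    exact setIntegral_nonneg measurableSet_Ioi fun x hx =>
      mul_nonneg (le_of_lt hx) (Real.exp_pos _).le
  have hae := ae_eq_of_laplace_eq (f := fun x => ENNReal.ofReal x * P x)
    (g := fun x => ENNReal.ofReal r * ∫⁻ y, P y * k (x - y)) (by fun_prop) (by fun_prop)
    (fun l hl => by rw [hLX l hl]; exact ENNReal.ofReal_ne_top)
    (fun l hl => by
      have hcm : Measurable fun x => ∫⁻ y, P y * k (x - y) := by fun_prop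
      rw [hLX l hl]
      simp_rw [mul_left_comm _ (ENNReal.ofReal r)]
      rw [lintegral_const_mul _ (by fun_prop), lintegral_exp_mul_conv hPm hkm, hLP l hl, hLk l hl,
        ← ENNReal.ofReal_mul (Real.exp_pos _).le, ← ENNReal.ofReal_mul hr.le]
      ring_nf)
  filter_upwards [hae] with x hx hx0
  rw [← hx, ENNReal.ofReal_mul hx0.le]
  simp only [hP, indicator_of_mem (mem_Ioi.2 hx0)]

theorem lintegral_size_bias_le {ν : Measure ℝ}
    (hν : ∫⁻ x in Ioi (0:ℝ), ENNReal.ofReal (min 1 x) ∂ν ≠ ⊤)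
    {νd : ℝ → ℝ} (hνd : Measurable νd) (hνd_nn : ∀ t, 0 ≤ νd t)
    (hν_dens : ν = volume.withDensity ((Ioi 0).indicator fun x => ENNReal.ofReal (νd x)))
    {δ : ℝ} (hδ : 0 < δ) :
    ∫⁻ u in Ioc 0 δ, (Ioi 0).indicator (fun y => ENNReal.ofReal (y * νd y)) u
      ≤ ENNReal.ofReal (Real.exp 1 * ∫ x in Ioi (0:ℝ), x * Real.exp (-δ⁻¹ * x) ∂ν) := by
  rw [← integral_const_mul, ofReal_integral_eq_lintegral_ofReal
    ((integrable_mul_exp hν (inv_pos.2 hδ)).const_mul _) (by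
      filter_upwards [ae_restrict_mem measurableSet_Ioi] with x hx
      exact mul_nonneg (Real.exp_pos _).le (mul_nonneg (le_of_lt hx) (Real.exp_pos _).le)), hν_dens,
    setLIntegral_withDensity_eq_setLIntegral_mul _
      (hνd.ennreal_ofReal.indicator measurableSet_Ioi) (by fun_prop) measurableSet_Ioi]
  refine (setLIntegral_mono_ae' measurableSet_Ioc (ae_of_all _ fun x hx => ?_)).trans
    (lintegral_mono_set Ioc_subset_Ioi_self)
  have hx0 : x ∈ Ioi (0:ℝ) := hx.1
  simp only [Pi.mul_apply, indicator_of_mem hx0]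
  rw [← ENNReal.ofReal_mul (hνd_nn x)]
  refine ENNReal.ofReal_le_ofReal ?_
  have h1 : 1 ≤ Real.exp 1 * Real.exp (-δ⁻¹ * x) := by
    rw [← Real.exp_add]
    refine Real.one_le_exp ?_
    have : δ⁻¹ * x ≤ 1 := by
      rw [inv_mul_eq_div, div_le_one hδ]; exact hx.2
    linarith
  have h2 : 0 ≤ x * νd x := mul_nonneg (le_of_lt hx.1) (hνd_nn x)
  calc x * νd x = x * νd x * 1 := (mul_one _).symm
    _ ≤ x * νd x * (Real.exp 1 * Real.exp (-δ⁻¹ * x)) := by gcongr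
    _ = _ := by ring

theorem measureReal_Icc_eq_integral {μ : Measure ℝ} {p : ℝ → ℝ} (hp : Continuous p)
    (hp0 : ∀ x, 0 ≤ p x)
    (hμ : μ = volume.withDensity ((Ioi 0).indicator fun x => ENNReal.ofReal (p x)))
    {a b : ℝ} (ha : 0 ≤ a) : μ.real (Icc a b) = ∫ x in Icc a b, p x := by
  rw [measureReal_def, integral_eq_lintegral_of_nonneg_ae (ae_of_all _ hp0)
    hp.measurable.aestronglyMeasurable, hμ, withDensity_apply _ measurableSet_Icc]
  congr 1
  rw [← setLIntegral_congr Ioc_ae_eq_Icc, ← setLIntegral_congr Ioc_ae_eq_Icc]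
  refine setLIntegral_congr_fun measurableSet_Ioc fun x hx => ?_
  exact indicator_of_mem (mem_Ioi.2 (ha.trans_lt hx.1)) _

theorem integral_mul_exp_anti {ν : Measure ℝ}
    (hν : ∫⁻ x in Ioi (0:ℝ), ENNReal.ofReal (min 1 x) ∂ν ≠ ⊤) {u s : ℝ} (hu : 0 < u)
    (hus : u ≤ s) :
    ∫ x in Ioi (0:ℝ), x * Real.exp (-s * x) ∂ν ≤ ∫ x in Ioi (0:ℝ), x * Real.exp (-u * x) ∂ν := by
  refine setIntegral_mono_on (integrable_mul_exp hν (hu.trans_le hus)) (integrable_mul_exp hν hu)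
    measurableSet_Ioi fun x hx => ?_
  have hx : 0 < x := hx
  gcongr

set_option maxHeartbeats 1000000 in
/-- Theorem 4.4, large-value regime.  Under Assumption 4.1, for each
`L > 0` there exist constants `c₂, c₃ ≥ 1` such that for all `r, t > 0` with
`r φ(1/t) ≥ L`:
`(1/(c₂ t)) exp(−c₃ t (φ')⁻¹(t/r)) ≤ p̄(r,t) ≤ (c₂/t) exp(−(1/c₃) t (φ')⁻¹(t/r))`,
where `φ'(λ) = ∫₀^∞ x e^{−λx} ν(dx)` and `(φ')⁻¹(l) = inf{s > 0 : φ'(s) ≤ l}`. -/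
theorem time_frac_stmt11
    (ν : Measure ℝ)
    (hν_loc : ∫⁻ x in Set.Ioi (0:ℝ), ENNReal.ofReal (min 1 x) ∂ν ≠ ⊤)
    (φ : ℝ → ℝ)
    (hφ : ∀ l : ℝ, 0 < l → φ l = ∫ x in Set.Ioi (0:ℝ), (1 - Real.exp (-l * x)) ∂ν)
    -- Assumption 4.1(i): weak scaling of φ
    (β₁ β₂ c₁ c₂ : ℝ)
    (hβ : 0 < β₁ ∧ β₁ < β₂ ∧ β₂ < 1) (hc : 0 < c₁ ∧ 0 < c₂)
    (hscale : ∀ l : ℝ, 0 < l → ∀ κ : ℝ, 1 ≤ κ →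
      c₁ * κ ^ β₁ ≤ φ (κ * l) / φ l ∧ φ (κ * l) / φ l ≤ c₂ * κ ^ β₂)
    -- Assumption 4.1(ii): ν has a density νd with t ↦ t·νd(t) non-increasing
    (νd : ℝ → ℝ)
    (hνd_nn : ∀ t : ℝ, 0 ≤ νd t)
    (hνd_meas : Measurable νd)
    (hν_dens : ∀ A : Set ℝ, MeasurableSet A →
      ν A = ∫⁻ x in A ∩ Set.Ioi 0, ENNReal.ofReal (νd x))
    (hself : AntitoneOn (fun t => t * νd t) (Set.Ioi (0:ℝ)))
    -- the derivative φ' of the Laplace exponent and its generalized right inverse ψ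
    (φd : ℝ → ℝ)
    (hφd : ∀ l : ℝ, 0 < l → φd l = ∫ x in Set.Ioi (0:ℝ), x * Real.exp (-l * x) ∂ν)
    (ψ : ℝ → ℝ)
    (hψ : ∀ l : ℝ, 0 ≤ l → ψ l = sInf {s : ℝ | 0 < s ∧ φd s ≤ l})
    -- the subordinator marginals and their continuous densities
    (μr : ℝ → Measure ℝ)
    (hprob : ∀ r : ℝ, 0 < r → IsProbabilityMeasure (μr r))
    (hlap : ∀ r : ℝ, 0 < r → ∀ l : ℝ, 0 < l →
      ∫ s, Real.exp (-l * s) ∂(μr r) = Real.exp (-r * φ l))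
    (pbar : ℝ → ℝ → ℝ)
    (hpbar_nn : ∀ r t : ℝ, 0 ≤ pbar r t)
    (hpbar_cont : ∀ r : ℝ, 0 < r → Continuous (pbar r))
    (hdens : ∀ r : ℝ, 0 < r → ∀ A : Set ℝ, MeasurableSet A →
      μr r A = ∫⁻ t in A ∩ Set.Ici 0, ENNReal.ofReal (pbar r t)) :
    ∀ L : ℝ, 0 < L → ∃ C₂ C₃ : ℝ, 1 ≤ C₂ ∧ 1 ≤ C₃ ∧
      ∀ r t : ℝ, 0 < r → 0 < t → L ≤ r * φ t⁻¹ →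
        (1 / (C₂ * t)) * Real.exp (-(C₃ * (t * ψ (t / r)))) ≤ pbar r t ∧
        pbar r t ≤ (C₂ / t) * Real.exp (-(C₃⁻¹ * (t * ψ (t / r)))) := by
  intro L hL
  obtain ⟨hβ1, -, hβ2⟩ := hβ
  have hν_wd : ν = volume.withDensity ((Ioi 0).indicator fun x => ENNReal.ofReal (νd x)) :=
    eq_withDensity_indicator (ae_eq_refl _) hν_dens
  have hμ_wd : ∀ r, 0 < r →
      μr r = volume.withDensity ((Ioi 0).indicator fun x => ENNReal.ofReal (pbar r x)) :=
    fun r hr => eq_withDensity_indicator Ioi_ae_eq_Ici.symm (hdens r hr)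
  have hμ0 : ∀ r, 0 < r → ∀ᵐ x ∂(μr r), 0 ≤ x := fun r hr => by
    have : μr r (Iio 0) = 0 := by
      rw [hdens r hr _ measurableSet_Iio, Iio_inter_Ici, Ico_self]
      simp
    filter_upwards [measure_eq_zero_iff_ae_notMem.1 this] with x hx using not_lt.1 hx
  -- elementary properties of the Laplace exponent
  have hderiv : ∀ l, 0 < l → HasDerivAt φ (φd l) l := fun l hl => by
    rw [hφd l hl]
    refine (hasDerivAt_integral_one_sub_exp hν_loc hl).congr_of_eventuallyEq ?_
    filter_upwards [Ioi_mem_nhds hl] with s hs using hφ s hs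
  have hφd_anti : ∀ u s, 0 < u → u ≤ s → φd s ≤ φd u := fun u s hu hus => by
    rw [hφd u hu, hφd s (hu.trans_le hus)]
    exact integral_mul_exp_anti hν_loc hu hus
  have hφd_le : ∀ s, 0 < s → s * φd s ≤ φ s := fun s hs => by
    rw [hφd s hs, hφ s hs]
    exact mul_integral_mul_exp_le hν_loc hs
  have hφd_nn : ∀ s, 0 < s → 0 ≤ φd s := fun s hs => by
    rw [hφd s hs]
    exact setIntegral_nonneg measurableSet_Ioi fun x hx =>
      mul_nonneg (le_of_lt hx) (Real.exp_pos _).le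
  have hlow : ∀ u s, 0 < u → u ≤ s → (s - u) * φd s ≤ φ s - φ u := fun u s hu hus => by
    rw [hφd s (hu.trans_le hus), hφ s (hu.trans_le hus), hφ u hu]
    exact sub_mul_integral_mul_exp_le hν_loc hu hus
  have hupp : ∀ u s, 0 < u → u ≤ s → φ s - φ u ≤ (s - u) * φd u := fun u s hu hus => by
    rw [hφd u hu, hφ s (hu.trans_le hus), hφ u hu]
    exact integral_sub_le_sub_mul_integral hν_loc hu hus
  have hφ_mono : ∀ u s, 0 < u → u ≤ s → φ u ≤ φ s := fun u s hu hus => by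
    have := mul_nonneg (sub_nonneg.2 hus) (hφd_nn s (hu.trans_le hus))
    linarith [hlow u s hu hus]
  have hφ_pos : ∀ s, 0 < s → 0 < φ s := fun s hs => by
    have h0 : 0 ≤ φ s := (mul_nonneg hs.le (hφd_nn s hs)).trans (hφd_le s hs)
    refine lt_of_le_of_ne h0 fun h => ?_
    have := (hscale s hs 1 le_rfl).1
    rw [← h, div_zero, Real.one_rpow, mul_one] at this
    linarith [hc.1]
  obtain ⟨D, hD, hge⟩ : ∃ D : ℝ, 0 < D ∧ ∀ s, 0 < s → φ s ≤ D * (s * φd s) := by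
    have hκ : ∃ κ : ℝ, 1 < κ ∧ 2 ≤ c₁ * κ ^ β₁ := by
      have h := ((tendsto_rpow_atTop hβ1).const_mul_atTop hc.1).eventually_ge_atTop 2
      obtain ⟨κ, h1, h2⟩ := ((eventually_gt_atTop 1).and h).exists
      exact ⟨κ, h1, h2⟩
    obtain ⟨κ, hκ1, hκ2⟩ := hκ
    refine ⟨κ - 1, by linarith, fun s hs => ?_⟩
    have h1 := hκ2.trans (hscale s hs κ hκ1.le).1
    rw [le_div_iff₀ (hφ_pos s hs)] at h1
    have h2 := hupp s (κ * s) hs (by nlinarith)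
    linarith
  have hsub : ∀ ε, 0 < ε → ∃ x₀, 0 < x₀ ∧ x₀ ≤ 1 ∧
      ∀ x, 0 < x → x ≤ x₀ → ∀ s, 0 < s → x * φ s ≤ ε * φ (x * s) := fun ε hε =>
    exists_mul_le_of_upper_scaling hβ2 hc.2 hφ_pos (fun l hl κ hκ => (hscale l hl κ hκ).2) hε
  -- the scales at which the estimates are run
  obtain ⟨η, hη, -, hηs⟩ := hsub (L / (2 * D)) (by positivity)
  obtain ⟨xθ, hxθ, -, hθs⟩ := hsub (1 / 2) (by positivity)
  obtain ⟨xB, hxB, -, hBs⟩ := hsub (1 / (4 * Real.exp 1 * D)) (by positivity)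
  obtain ⟨xα, hxα, hxα1, hαs⟩ := hsub (1 / (2 * D)) (by positivity)
  set θ := xθ / 2 with hθ
  set B := max (2 / xB) (4 / η) with hB
  have hB0 : 0 < B := lt_max_of_lt_left (by positivity)
  set γ := (1 - Real.exp (-(xα * η / 8))) / 2 with hγ
  have hγ0 : 0 < γ := by
    have : Real.exp (-(xα * η / 8)) < 1 := Real.exp_lt_one_iff.2 (by
      have := mul_pos hxα hη
      linarith)
    rw [hγ]; linarith
  set M := 8 * D / xα / γ + 1 with hM
  have hM1 : 1 ≤ M := by rw [hM]; linarith [show 0 ≤ 8 * D / xα / γ by positivity]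
  have hM0 : 0 < M := by linarith
  refine ⟨max 1 (max (4 * B / θ) (M * Real.exp 1 / γ)), max 1 (max (2 / θ) (2 * D + M * B)),
    le_max_left _ _, le_max_left _ _, fun r t hr ht hLr => ?_⟩
  have := hprob r hr
  have htr : 0 < t / r := by positivity
  obtain ⟨hw, hw2, hw1⟩ := sInf_derivative_le_bounds hD hφ_pos hφd_anti hφd_le hge hsub htr
  rw [← hψ (t / r) htr.le] at hw hw2 hw1
  set w := ψ (t / r) with hwdef
  rw [le_div_iff₀ hr] at hw2
  rw [div_le_iff₀ hr] at hw1
  -- the two-sided comparison of `r φ` with `t w` around the scale `w`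
  have hφ2w : r * φ (2 * w) ≤ 2 * D * (w * t) := by
    calc r * φ (2 * w) ≤ r * (D * (2 * w * φd (2 * w))) := by
          gcongr; exact hge _ (by linarith)
      _ = 2 * D * w * (φd (2 * w) * r) := by ring
      _ ≤ 2 * D * w * t := by gcongr
      _ = _ := by ring
  have hφw2 : t * (w / 2) ≤ r * φ (w / 2) := by
    calc t * (w / 2) ≤ φd (w / 2) * r * (w / 2) := by gcongr
      _ = r * (w / 2 * φd (w / 2)) := by ring
      _ ≤ _ := by gcongr; exact hφd_le _ (by linarith)
  have htw : η ≤ 2 * w * t := by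
    by_contra! hcon
    have h1 := hηs (2 * w * t) (by positivity) hcon.le t⁻¹ (by positivity)
    rw [mul_inv_cancel_right₀ ht.ne'] at h1
    have h2 : 2 * w * t * L ≤ w * t * L := by
      calc 2 * w * t * L ≤ 2 * w * t * (r * φ t⁻¹) := by gcongr
        _ = r * (2 * w * t * φ t⁻¹) := by ring
        _ ≤ r * (L / (2 * D) * φ (2 * w)) := by gcongr
        _ = L / (2 * D) * (r * φ (2 * w)) := by ring
        _ ≤ L / (2 * D) * (2 * D * (w * t)) := by gcongr
        _ = w * t * L := by field_simp
    have := mul_pos (mul_pos hw ht) hL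
    linarith
  have hBt : 2 ≤ B * w * t := by
    have h1 : 4 / η * (w * t) ≤ B * (w * t) := by gcongr; exact le_max_right _ _
    have h2 : 2 ≤ 4 / η * (w * t) := by
      rw [div_mul_eq_mul_div, le_div_iff₀ hη]; linarith
    linarith
  have hBφ : r * (Real.exp 1 * φd (B * w)) ≤ t / 4 := by
    have hb : 0 < 2 / xB * w := by positivity
    have h1 : φd (B * w) ≤ φd (2 / xB * w) := hφd_anti _ _ hb (by gcongr; exact le_max_left _ _)
    have h2 := hBs xB hxB le_rfl (2 / xB * w) hb
    rw [show xB * (2 / xB * w) = 2 * w by field_simp] at h2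
    have h3 : 2 * w * φd (2 / xB * w) ≤ 1 / (4 * Real.exp 1 * D) * φ (2 * w) := by
      refine le_trans ?_ h2
      have := hφd_le (2 / xB * w) hb
      calc 2 * w * φd (2 / xB * w) = xB * (2 / xB * w * φd (2 / xB * w)) := by field_simp
        _ ≤ _ := by gcongr
    have h4 : 2 * w * (r * (Real.exp 1 * φd (2 / xB * w))) ≤ 2 * w * (t / 4) := by
      calc _ = r * Real.exp 1 * (2 * w * φd (2 / xB * w)) := by ring
        _ ≤ r * Real.exp 1 * (1 / (4 * Real.exp 1 * D) * φ (2 * w)) := by gcongr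
        _ = 1 / (4 * D) * (r * φ (2 * w)) := by field_simp
        _ ≤ 1 / (4 * D) * (2 * D * (w * t)) := by gcongr
        _ = _ := by field_simp
    refine le_trans ?_ (le_of_mul_le_mul_left h4 (by positivity))
    gcongr
  have hdoub : ∀ a, t / 2 ≤ a → ∀ u ∈ Icc 0 (B * w)⁻¹, pbar r (a + u) ≤ 2 * pbar r a := by
    intro a ha u hu
    refine le_two_mul_of_size_bias_conv (hpbar_cont r hr) (hpbar_nn r)
      ((measurable_id.mul hνd_meas).ennreal_ofReal.indicator measurableSet_Ioi)
      (fun x hx => indicator_of_notMem (by simpa using hx) _) ?_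
      (ofReal_mul_density_eq_conv hν_loc hr hderiv hφd hνd_meas hνd_nn hν_wd
        (hpbar_cont r hr).measurable (hlap r hr) (hμ_wd r hr)) (by linarith) (by positivity) ?_ hu
    · intro x hx y hy hxy
      simp only [indicator_of_mem hx, indicator_of_mem hy]
      exact ENNReal.ofReal_le_ofReal (hself hx hy hxy)
    · refine (mul_le_mul_right (lintegral_size_bias_le hν_loc hνd_meas hνd_nn hν_wd
        (by positivity)) _).trans ?_
      rw [inv_inv, ← hφd _ (by positivity), ← ENNReal.ofReal_mul hr.le]
      exact ENNReal.ofReal_le_ofReal (by linarith)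
  have hIcc : ∀ a b, 0 ≤ a → (μr r).real (Icc a b) = ∫ x in Icc a b, pbar r x := fun a b ha =>
    measureReal_Icc_eq_integral (hpbar_cont r hr) (hpbar_nn r) (hμ_wd r hr) ha
  have hpint : ∀ a b, IntegrableOn (pbar r) (Icc a b) := fun a b =>
    (hpbar_cont r hr).continuousOn.integrableOn_Icc
  constructor
  · set l := xα * w / 4 with hl
    have hl0 : 0 < l := by positivity
    have hφd2l : 2 * t ≤ r * φd (2 * l) := by
      have h1 := hαs xα hxα le_rfl (w / 2) (by positivity)
      rw [show xα * (w / 2) = 2 * l by rw [hl]; ring] at h1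
      have h2 : xα * (w / 2) * t ≤ xα * (w / 2) * (r * φd (2 * l) / 2) := by
        calc xα * (w / 2) * t = xα * (t * (w / 2)) := by ring
          _ ≤ xα * (r * φ (w / 2)) := by gcongr
          _ = r * (xα * φ (w / 2)) := by ring
          _ ≤ r * (1 / (2 * D) * φ (2 * l)) := by gcongr
          _ ≤ r * (1 / (2 * D) * (D * (2 * l * φd (2 * l)))) := by
              gcongr; exact hge _ (by positivity)
          _ = r * (2 * l * φd (2 * l)) / 2 := by field_simp
          _ = _ := by rw [show xα * (w / 2) = 2 * l by rw [hl]; ring]; ring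
      have := le_of_mul_le_mul_left h2 (by positivity)
      linarith
    have hl2w : l ≤ 2 * w := by rw [hl]; nlinarith
    have hrφl : r * φ l ≤ 2 * D * (w * t) :=
      le_trans (by gcongr; exact hφ_mono _ _ hl0 hl2w) hφ2w
    have hmean : r * φd l ≤ 8 * D / xα * t := by
      have h1 : l * (r * φd l) ≤ l * (8 * D / xα * t) := by
        calc l * (r * φd l) = r * (l * φd l) := by ring
          _ ≤ r * φ l := by gcongr; exact hφd_le _ hl0
          _ ≤ 2 * D * (w * t) := hrφl
          _ = _ := by rw [hl]; field_simp; ring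
      exact le_of_mul_le_mul_left h1 hl0
    have hgap : 2 * (l * t) ≤ r * φ (2 * l) - r * φ l := by
      calc 2 * (l * t) = l * (2 * t) := by ring
        _ ≤ l * (r * φd (2 * l)) := by gcongr
        _ = r * ((2 * l - l) * φd (2 * l)) := by ring
        _ ≤ r * (φ (2 * l) - φ l) := by gcongr; exact hlow _ _ hl0 (by linarith)
        _ = _ := by ring
    obtain ⟨hi, he⟩ := integral_mul_exp_eq (hμ0 r hr) (hlap r hr) hl0 (hderiv l hl0)
    have hmass := measureReal_Icc_ge (hμ0 r hr) (t := t) hl0 (mul_pos hM0 ht) hi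
    rw [he, hlap r hr l hl0, hlap r hr (2 * l) (by positivity)] at hmass
    have hm : γ * Real.exp (-(2 * D * (w * t))) ≤ (μr r).real (Icc t (M * t)) := by
      refine le_trans ?_ hmass
      have e1 : Real.exp (l * t) * Real.exp (-r * φ (2 * l))
          ≤ Real.exp (-(xα * η / 8)) * Real.exp (-r * φ l) := by
        rw [← Real.exp_add, ← Real.exp_add]
        refine Real.exp_le_exp.2 ?_
        have : xα * η ≤ xα * (2 * w * t) := by gcongr
        have : l * t = xα * (2 * w * t) / 8 := by rw [hl]; ring
        linarith
      have e2 : (M * t)⁻¹ * (r * φd l * Real.exp (-r * φ l)) ≤ γ * Real.exp (-r * φ l) := by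
        rw [← mul_assoc]
        gcongr
        rw [inv_mul_le_iff₀ (by positivity)]
        refine hmean.trans ?_
        have : M * t * γ = 8 * D / xα * t + t * γ := by rw [hM]; field_simp
        have := mul_pos ht hγ0
        linarith
      have e3 : Real.exp (-(2 * D * (w * t))) ≤ Real.exp (-r * φ l) :=
        Real.exp_le_exp.2 (by linarith)
      have e4 : γ * Real.exp (-(2 * D * (w * t))) ≤ γ * Real.exp (-r * φ l) := by gcongr
      have e5 : Real.exp (-(xα * η / 8)) = 1 - 2 * γ := by rw [hγ]; ring
      rw [e5] at e1
      linarith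
    have hlb := density_lower_bound_of_doubling (hpbar_nn r) (m := (μr r).real (Icc t (M * t)))
      (fun c hc => by
        rw [hIcc _ _ ht.le]
        refine (setIntegral_mono_on (hpint _ _) (by simp) measurableSet_Icc hc).trans ?_
        rw [setIntegral_const, smul_eq_mul, Real.volume_real_Icc_of_le (by nlinarith)])
      ht hw hB0 hM1 (fun a ha => hdoub a (by linarith))
    refine le_trans ?_ hlb
    set C₂ := max 1 (max (4 * B / θ) (M * Real.exp 1 / γ)) with hC₂
    set C₃ := max 1 (max (2 / θ) (2 * D + M * B)) with hC₃
    have hC2 : M * Real.exp 1 / γ ≤ C₂ := (le_max_right _ _).trans (le_max_right _ _)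
    have hC3 : 2 * D + M * B ≤ C₃ := (le_max_right _ _).trans (le_max_right _ _)
    calc 1 / (C₂ * t) * Real.exp (-(C₃ * (t * w)))
        ≤ 1 / (M * Real.exp 1 / γ * t) * Real.exp (-((2 * D + M * B) * (t * w))) := by gcongr
      _ = (γ * Real.exp (-(2 * D * (w * t)))) / (M * Real.exp 1 * t)
            * Real.exp (-(M * B * (t * w))) := by
          rw [show -((2 * D + M * B) * (t * w)) = -(2 * D * (w * t)) + -(M * B * (t * w)) by ring,
            Real.exp_add]
          field_simp
      _ ≤ _ := by gcongr
  · have hθ0 : 0 < θ := by positivity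
    have htail : ∀ a, (μr r).real (Icc a t) ≤ Real.exp (-(θ * (w * t))) := by
      intro a
      have h1 := hθs xθ hxθ le_rfl (w / 2) (by positivity)
      rw [show xθ * (w / 2) = θ * w by rw [hθ]; ring] at h1
      have h2 : 2 * (θ * (w * t)) ≤ r * φ (θ * w) := by
        have : xθ * (t * (w / 2)) ≤ r * (1 / 2 * φ (θ * w)) :=
          calc xθ * (t * (w / 2)) ≤ xθ * (r * φ (w / 2)) := by gcongr
            _ = r * (xθ * φ (w / 2)) := by ring
            _ ≤ _ := by gcongr
        have h3 : 2 * (θ * (w * t)) = 2 * (xθ * (t * (w / 2))) := by rw [hθ]; ring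
        linarith
      calc (μr r).real (Icc a t) ≤ (μr r).real (Iic t) := measureReal_mono Icc_subset_Iic_self
        _ ≤ _ := measureReal_Iic_le (hμ0 r hr) (l := θ * w) (by positivity) t
        _ = Real.exp (θ * w * t + -r * φ (θ * w)) := by
            rw [hlap r hr _ (by positivity), Real.exp_add]
        _ ≤ _ := by gcongr; linarith
    have hub := density_upper_bound_of_doubling (p := pbar r)
      (m := fun a b => (μr r).real (Icc a b))
      (fun a b c ha hab hc => by
        rw [hIcc _ _ ha]
        refine le_trans ?_ (setIntegral_mono_on (f := fun _ => c) (by simp) (hpint _ _)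
          measurableSet_Icc hc)
        rw [setIntegral_const, smul_eq_mul, Real.volume_real_Icc_of_le hab])
      ht hw hB0 hθ0 hBt hdoub htail
    refine hub.trans ?_
    set C₂ := max 1 (max (4 * B / θ) (M * Real.exp 1 / γ)) with hC₂
    set C₃ := max 1 (max (2 / θ) (2 * D + M * B)) with hC₃
    have hC2 : 4 * B / θ ≤ C₂ := (le_max_left _ _).trans (le_max_right _ _)
    have hC3 : C₃⁻¹ ≤ θ / 2 := by
      rw [← inv_div]
      exact inv_anti₀ (by positivity) ((le_max_left _ _).trans (le_max_right _ _))
    gcongr
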